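/- Let φ = C_1 ∧ … ∧ C_m be a CNF formula over variables V and F_φ its standard translation. For every truth assignment θ over V with θ ⊨ φ, the set of arguments θ ∪ {φ} (the literal arguments true under θ together with the argument φ) is both a stable extension and a complete extension of F_φ. -/

import Mathlib

def conflictFree {α : Type*} (A : Set α) (R : Set (α × α)) (E : Set α) : Prop :=
  E ⊆ A ∧ ∀ x ∈ E, ∀ y ∈ E, (x, y) ∉ R

def defended {α : Type*} (R : Set (α × α)) (E : Set α) (x : α) : Prop :=
  ∀ y, (y, x) ∈ R → ∃ z ∈ E, (z, y) ∈ R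

def admissible {α : Type*} (A : Set α) (R : Set (α × α)) (E : Set α) : Prop :=
  conflictFree A R E ∧ ∀ x ∈ E, defended R E x

def stable {α : Type*} (A : Set α) (R : Set (α × α)) (E : Set α) : Prop :=
  conflictFree A R E ∧ ∀ x ∈ A, x ∉ E → ∃ y ∈ E, (y, x) ∈ R

def naive {α : Type*} (A : Set α) (R : Set (α × α)) (E : Set α) : Prop :=
  conflictFree A R E ∧ ∀ E', E ⊂ E' → ¬ conflictFree A R E'

def preferred {α : Type*} (A : Set α) (R : Set (α × α)) (E : Set α) : Prop :=
  admissible A R E ∧ ∀ E', E ⊂ E' → ¬ admissible A R E'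

def complete {α : Type*} (A : Set α) (R : Set (α × α)) (E : Set α) : Prop :=
  admissible A R E ∧ ∀ x ∈ A, defended R E x → x ∈ E

def credAccepted {α : Type*} (σ : Set α → Prop) (x : α) : Prop :=
  ∃ E, σ E ∧ x ∈ E

def isFacet {α : Type*} (σ : Set α → Prop) (x : α) : Prop :=
  (∃ E, σ E ∧ x ∈ E) ∧ ¬ ∀ E, σ E → x ∈ E

/-- A literal over variables `V`: a variable or its negation. -/
inductive Lit (V : Type*) where
  | pos (x : V)
  | neg (x : V)
deriving DecidableEq

/-- The complement of a literal. -/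
def Lit.compl {V : Type*} : Lit V → Lit V
  | .pos x => .neg x
  | .neg x => .pos x

/-- Evaluation of a literal under a truth assignment. -/
def Lit.eval {V : Type*} (θ : V → Bool) : Lit V → Bool
  | .pos x => θ x
  | .neg x => !θ x

/-- An assignment satisfies a clause (a finite set of literals). -/
def satClause {V : Type*} (θ : V → Bool) (c : Finset (Lit V)) : Prop :=
  ∃ ℓ ∈ c, Lit.eval θ ℓ = true

/-- An assignment satisfies a CNF with clauses `C 0, …, C (m-1)`. -/
def satCNF {V : Type*} {m : ℕ} (θ : V → Bool) (C : Fin m → Finset (Lit V)) : Prop :=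
  ∀ i, satClause θ (C i)

/-- The arguments of the standard translation `F_φ`: the formula argument,
one argument per clause, and one argument per literal. -/
inductive Arg (V : Type*) (m : ℕ) where
  | fm
  | clause (i : Fin m)
  | lit (ℓ : Lit V)

/-- The attack relation of the standard translation `F_φ`. -/
def attacksOf {V : Type*} {m : ℕ} (C : Fin m → Finset (Lit V)) :
    Set (Arg V m × Arg V m) :=
  {p | (∃ i : Fin m, p = (Arg.clause i, Arg.fm)) ∨
       (∃ ℓ : Lit V, p = (Arg.lit ℓ, Arg.lit ℓ.compl)) ∨
       (∃ i : Fin m, ∃ ℓ ∈ C i, p = (Arg.lit ℓ, Arg.clause i))}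

/-- The set of literal arguments made true by the assignment `θ`. -/
def thetaArgs {V : Type*} (m : ℕ) (θ : V → Bool) : Set (Arg V m) :=
  {x | ∃ ℓ : Lit V, Lit.eval θ ℓ = true ∧ x = Arg.lit ℓ}

/-- If `θ` satisfies `φ`, then the literal arguments true under `θ` together with
the formula argument form a stable and complete extension of `F_φ`. -/
theorem satisfying_assignment_stable_complete {V : Type*} [Fintype V] [DecidableEq V]
    {m : ℕ} (C : Fin m → Finset (Lit V)) (θ : V → Bool) (hθ : satCNF θ C) :
    stable Set.univ (attacksOf C) (thetaArgs m θ ∪ {Arg.fm}) ∧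
    complete Set.univ (attacksOf C) (thetaArgs m θ ∪ {Arg.fm}) := by
  have hst : stable Set.univ (attacksOf C) (thetaArgs m θ ∪ {Arg.fm}) := by
    refine ⟨⟨Set.subset_univ _, ?_⟩, ?_⟩
    · rintro x hx y hy (⟨i, h⟩ | ⟨l, h⟩ | ⟨i, l, hl, h⟩)
      · obtain ⟨rfl, rfl⟩ := Prod.mk.inj h
        simp [thetaArgs] at hx
      · obtain ⟨rfl, rfl⟩ := Prod.mk.inj h
        cases l <;> simp_all [thetaArgs, Lit.compl, Lit.eval]
      · obtain ⟨rfl, rfl⟩ := Prod.mk.inj h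
        simp [thetaArgs] at hy
    · intro x _ hx
      cases x with
      | fm => simp at hx
      | clause i =>
        obtain ⟨l, hl, he⟩ := hθ i
        exact ⟨Arg.lit l, Or.inl ⟨l, he, rfl⟩, Or.inr (Or.inr ⟨i, l, hl, rfl⟩)⟩
      | lit l =>
        refine ⟨Arg.lit l.compl, Or.inl ⟨l.compl, ?_, rfl⟩, Or.inr (Or.inl ⟨l.compl, ?_⟩)⟩
        · cases l <;> simp_all [thetaArgs, Lit.compl, Lit.eval]
        · cases l <;> rfl
  refine ⟨hst, ⟨hst.1, ?_⟩, ?_⟩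
  · intro x hx y hyx
    exact hst.2 y (Set.mem_univ _) (fun hy => hst.1.2 y hy x hx hyx)
  · intro x hx hd
    by_contra hn
    obtain ⟨y, hy, hyx⟩ := hst.2 x hx hn
    obtain ⟨z, hz, hzy⟩ := hd y hyx
    exact hst.1.2 z hz y hy hzy
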